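/- Let G be a finite connected graph. For all vertices x,y of G, τ_{x,y}(G) = max{g_w(x,y) : w ∈ V and d(x,w) ≤ h_{x,y}(w)}. -/

import Mathlib

open SimpleGraph

noncomputable section

namespace HypPaper

variable {V : Type*}

/-- Gromov product `(y|z)_w = (d(y,w)+d(z,w)-d(y,z))/2`. -/
def gp (G : SimpleGraph V) (y z w : V) : ℝ :=
  ((G.dist y w : ℝ) + (G.dist z w : ℝ) - (G.dist y z : ℝ)) / 2

/-- `G` is `δ`-hyperbolic. -/
def IsDeltaHyp (G : SimpleGraph V) (δ : ℝ) : Prop :=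
  ∀ w x y z : V, gp G x y w ≥ min (gp G x z w) (gp G y z w) - δ

/-- The hyperbolicity `δ(G)`: least `δ ≥ 0` such that `G` is `δ`-hyperbolic. -/
def hyperbolicity (G : SimpleGraph V) : ℝ :=
  sInf {δ : ℝ | 0 ≤ δ ∧ IsDeltaHyp G δ}

/-- Pointed hyperbolicity `δ_w(G)` with respect to basepoint `w`. -/
def pointedHyp (G : SimpleGraph V) (w : V) : ℝ :=
  sInf {δ : ℝ | ∀ x y z : V, gp G x y w ≥ min (gp G x z w) (gp G y z w) - δ}

/-- A walk is a geodesic (shortest path) if its length equals the distance. -/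
def IsGeodesic (G : SimpleGraph V) {x y : V} (p : G.Walk x y) : Prop :=
  p.length = G.dist x y

/-- Thinness condition at corner `v` of a triangle, with sides `p : v → u` and `q : v → u'`. -/
def ThinCorner (G : SimpleGraph V) (δ : ℝ) {v u u' : V}
    (p : G.Walk v u) (q : G.Walk v u') : Prop :=
  ∀ a ∈ p.support, ∀ b ∈ q.support,
    G.dist v a = G.dist v b → (G.dist v a : ℝ) ≤ gp G u u' v →
    (G.dist a b : ℝ) ≤ δ

/-- A geodesic triangle with sides `p : x → y`, `q : y → z`, `r : z → x` is `δ`-thin. -/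
def TriangleThin (G : SimpleGraph V) (δ : ℝ) {x y z : V}
    (p : G.Walk x y) (q : G.Walk y z) (r : G.Walk z x) : Prop :=
  ThinCorner G δ p r.reverse ∧ ThinCorner G δ q p.reverse ∧ ThinCorner G δ r q.reverse

/-- Thinness `τ(G)`: least `δ` such that every geodesic triangle is `δ`-thin. -/
def thinness (G : SimpleGraph V) : ℝ :=
  sInf {δ : ℝ | ∀ (x y z : V) (p : G.Walk x y) (q : G.Walk y z) (r : G.Walk z x),
    IsGeodesic G p → IsGeodesic G q → IsGeodesic G r → TriangleThin G δ p q r}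

/-- The insize `max {d(y_z,z_y), d(z_x,x_z), d(x_y,y_x)}` of a geodesic triangle with
sides `p : x → y`, `q : y → z`, `r : z → x`. -/
def triInsize (G : SimpleGraph V) {x y z : V}
    (p : G.Walk x y) (q : G.Walk y z) (r : G.Walk z x) : ℝ :=
  max (G.dist (p.getVert ⌊gp G y z x⌋₊) (r.reverse.getVert ⌊gp G y z x⌋₊) : ℝ)
    (max (G.dist (q.getVert ⌊gp G z x y⌋₊) (p.reverse.getVert ⌊gp G z x y⌋₊) : ℝ)
      (G.dist (r.getVert ⌊gp G x y z⌋₊) (q.reverse.getVert ⌊gp G x y z⌋₊) : ℝ))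

/-- Insize `ι(G)`: least upper bound on insizes of geodesic triangles. -/
def insize (G : SimpleGraph V) : ℝ :=
  sInf {δ : ℝ | ∀ (x y z : V) (p : G.Walk x y) (q : G.Walk y z) (r : G.Walk z x),
    IsGeodesic G p → IsGeodesic G q → IsGeodesic G r → triInsize G p q r ≤ δ}

/-- A geodesic triangle with sides `p : x → y`, `q : y → z`, `r : z → x` is `δ`-slim. -/
def TriangleSlim (G : SimpleGraph V) (δ : ℝ) {x y z : V}
    (p : G.Walk x y) (q : G.Walk y z) (r : G.Walk z x) : Prop :=
  (∀ a ∈ p.support, ∃ b, (b ∈ q.support ∨ b ∈ r.support) ∧ (G.dist a b : ℝ) ≤ δ) ∧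
  (∀ a ∈ q.support, ∃ b, (b ∈ r.support ∨ b ∈ p.support) ∧ (G.dist a b : ℝ) ≤ δ) ∧
  (∀ a ∈ r.support, ∃ b, (b ∈ p.support ∨ b ∈ q.support) ∧ (G.dist a b : ℝ) ≤ δ)

/-- Slimness `ς(G)`: least `δ` such that every geodesic triangle is `δ`-slim. -/
def slimness (G : SimpleGraph V) : ℝ :=
  sInf {δ : ℝ | ∀ (x y z : V) (p : G.Walk x y) (q : G.Walk y z) (r : G.Walk z x),
    IsGeodesic G p → IsGeodesic G q → IsGeodesic G r → TriangleSlim G δ p q r}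

/-- The metric interval `I(u,v)`. -/
def interval (G : SimpleGraph V) (u v : V) : Set V :=
  {x | G.dist u x + G.dist x v = G.dist u v}

/-- Interval thinness `κ(G)`. -/
def intervalThinness (G : SimpleGraph V) : ℝ :=
  sInf {κ : ℝ | ∀ x y a b : V, a ∈ interval G x y → b ∈ interval G x y →
    G.dist x a = G.dist x b → (G.dist a b : ℝ) ≤ κ}

/-- A BFS-tree of `G` rooted at `w`: a spanning tree (encoded by its parent function)
in which the path from `w` to any vertex is a shortest path of `G`. -/
structure BFSTree (G : SimpleGraph V) (w : V) where
  parent : V → V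
  parent_root : parent w = w
  adj_parent : ∀ x, x ≠ w → G.Adj (parent x) x
  dist_parent : ∀ x, x ≠ w → G.dist w (parent x) + 1 = G.dist w x

/-- The vertex of the tree path `[w,x]_T` at distance `r` from the root `w`
(for `r ≤ d(w,x)`). -/
def treeVert (G : SimpleGraph V) {w : V} (T : BFSTree G w) (x : V) (r : ℕ) : V :=
  T.parent^[G.dist w x - r] x

/-- `v` lies on the tree path `[w,x]_T`. -/
def onRootPath (G : SimpleGraph V) {w : V} (T : BFSTree G w) (x v : V) : Prop :=
  ∃ i ≤ G.dist w x, v = T.parent^[i] x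

/-- The rooted insize `ρ_{w,T}(G) = max {d(x_y, y_x) : x, y ∈ V}`, where `x_y`, `y_x` are
the vertices of `[w,x]_T`, `[w,y]_T` at distance `⌊(x|y)_w⌋` from `w`. -/
def rootedInsize (G : SimpleGraph V) {w : V} (T : BFSTree G w) : ℝ :=
  sSup {ρ : ℝ | ∃ x y : V,
    ρ = (G.dist (treeVert G T x ⌊gp G x y w⌋₊) (treeVert G T y ⌊gp G x y w⌋₊) : ℝ)}

/-- The rooted thinness `μ_{w,T}(G)`. -/
def rootedThinness (G : SimpleGraph V) {w : V} (T : BFSTree G w) : ℝ :=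
  sSup {μ : ℝ | ∃ x y x' y' : V, onRootPath G T x x' ∧ onRootPath G T y y' ∧
    G.dist w x' = G.dist w y' ∧ (G.dist w x' : ℝ) ≤ gp G x y w ∧
    μ = (G.dist x' y' : ℝ)}


theorem finite_setOf_intervalDist {V : Type*} [Fintype V] (G : SimpleGraph V) (x y w : V) :
    {g : ℝ | ∃ y' : V, y' ∈ interval G x y ∧ G.dist x y' = G.dist x w ∧
      g = (G.dist y' w : ℝ)}.Finite :=
  (Set.finite_range fun v : V => (G.dist v w : ℝ)).subset <| by
    rintro _ ⟨v, -, -, rfl⟩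
    exact ⟨v, rfl⟩

theorem finite_setOf_gp {V : Type*} [Fintype V] (G : SimpleGraph V) (x y w : V) :
    {h : ℝ | ∃ z : V, w ∈ interval G x z ∧ h = gp G y z x}.Finite :=
  (Set.finite_range fun z : V => gp G y z x).subset <| by
    rintro _ ⟨z, -, rfl⟩
    exact ⟨z, rfl⟩

theorem self_mem_interval {V : Type*} (G : SimpleGraph V) (x w : V) : w ∈ interval G x w := by
  simp [interval]

/-- `τ_{x,y}(G) = max { g_w(x,y) : w ∈ V, d(x,w) ≤ h_{x,y}(w) }`, where
`τ_{x,y}(G) = max {d(y',z') : y' ∈ I(x,y), ∃ z, z' ∈ I(x,z), d(x,y') = d(x,z') ≤ (y|z)_x}`,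
`g_w(x,y) = max {d(y',w) : y' ∈ I(x,y), d(x,y') = d(x,w)}` (with `max ∅ = 0`), and
`h_{x,y}(w) = max {(y|z)_x : z ∈ V, w ∈ I(x,z)}`. -/
theorem pointed_thinness_formula
    {V : Type*} [Fintype V] (G : SimpleGraph V) (hG : G.Connected) (x y : V) :
    sSup {t : ℝ | ∃ y' z' z : V, y' ∈ interval G x y ∧ z' ∈ interval G x z ∧
        G.dist x y' = G.dist x z' ∧ (G.dist x y' : ℝ) ≤ gp G y z x ∧
        t = (G.dist y' z' : ℝ)} =
    sSup {t : ℝ | ∃ w : V,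
        (G.dist x w : ℝ) ≤ sSup {h : ℝ | ∃ z : V, w ∈ interval G x z ∧ h = gp G y z x} ∧
        t = sSup {g : ℝ | ∃ y' : V, y' ∈ interval G x y ∧ G.dist x y' = G.dist x w ∧
          g = (G.dist y' w : ℝ)}} := by
  refine le_antisymm (Real.sSup_le ?_ ?_) (Real.sSup_le ?_ ?_)
  · rintro _ ⟨y', z', z, hy', hz', hd, hle, rfl⟩
    refine (le_csSup (finite_setOf_intervalDist G x y z').bddAbove ⟨y', hy', hd, rfl⟩).trans
      (le_csSup ?_ ⟨z', ?_, rfl⟩)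
    · refine ((Set.finite_range fun w : V => sSup {g : ℝ | ∃ y' : V, y' ∈ interval G x y ∧
        G.dist x y' = G.dist x w ∧ g = (G.dist y' w : ℝ)}).subset ?_).bddAbove
      rintro _ ⟨w, -, rfl⟩
      exact ⟨w, rfl⟩
    · rw [← hd]
      exact hle.trans (le_csSup (finite_setOf_gp G x y z').bddAbove ⟨z, hz', rfl⟩)
  · refine Real.sSup_nonneg ?_
    rintro _ ⟨w, -, rfl⟩
    refine Real.sSup_nonneg ?_
    rintro _ ⟨y', -, -, rfl⟩
    positivity
  · rintro _ ⟨w, hw, rfl⟩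
    obtain ⟨z, hz, hmax⟩ := Set.Nonempty.csSup_mem
      (s := {h : ℝ | ∃ z : V, w ∈ interval G x z ∧ h = gp G y z x})
      ⟨gp G y w x, w, self_mem_interval G x w, rfl⟩ (finite_setOf_gp G x y w)
    refine Real.sSup_le ?_ ?_
    · rintro _ ⟨y', hy', hd, rfl⟩
      refine le_csSup ?_ ⟨y', w, z, hy', hz, hd, ?_, rfl⟩
      · refine ((Set.finite_range fun p : V × V => (G.dist p.1 p.2 : ℝ)).subset ?_).bddAbove
        rintro _ ⟨a, b, -, -, -, -, -, rfl⟩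
        exact ⟨(a, b), rfl⟩
      · rw [hd, ← hmax]
        exact hw
    · refine Real.sSup_nonneg ?_
      rintro _ ⟨a, b, -, -, -, -, -, rfl⟩
      positivity
  · refine Real.sSup_nonneg ?_
    rintro _ ⟨a, b, -, -, -, -, -, rfl⟩
    positivity

end HypPaper
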